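/- arXiv:1201.2754 — 2 statements merged into one kernel-verified Lean document; each statement's English description precedes it below -/
import Mathlib

section
/- Let θ, μ ∈ ℝ with μ > 0 and |μ cos(πθ)| > 1, q = e^{2πiθ}, z = e^{iπθ}/(2i cos(πθ)), and let A⁰_{μ,θ} be the quotient of the free unital associative ℂ-algebra on generators W, W°, Λ, Λ° by the two-sided ideal generated by WΛ − qΛW, WΛ° − conj(q)Λ°W, W°Λ° − qΛ°W°, W°Λ − conj(q)ΛW°, ΛΛ° − 1, Λ°Λ − 1, WW° − (zΛ + conj(z)Λ° + μ·1), and W°W − (−conj(z)Λ − zΛ° + μ·1). Then A⁰_{μ,θ} is a nontrivial algebra; in particular 1 ≠ 0 in A⁰_{μ,θ}. -/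
open Real Complex

noncomputable section

/-- The free unital associative ℂ-algebra on four generators `W, W°, Λ, Λ°`. -/
abbrev FreeFour := FreeAlgebra ℂ (Fin 4)

def Wg : FreeFour := FreeAlgebra.ι ℂ (0 : Fin 4)
def Wog : FreeFour := FreeAlgebra.ι ℂ (1 : Fin 4)
def Lg : FreeFour := FreeAlgebra.ι ℂ (2 : Fin 4)
def Log : FreeFour := FreeAlgebra.ι ℂ (3 : Fin 4)

def qc (θ : ℝ) : ℂ := Complex.exp (2 * Real.pi * θ * Complex.I)
def zc (θ : ℝ) : ℂ :=
  Complex.exp (Real.pi * θ * Complex.I) / (2 * Complex.I * (Real.cos (Real.pi * θ) : ℂ))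

/-- The eight defining relations of the deformed torus algebra `A⁰_{μ,θ}`. -/
inductive TorusRel (θ μ : ℝ) : FreeFour → FreeFour → Prop
  | rel1 : TorusRel θ μ (Wg * Lg) (qc θ • (Lg * Wg))
  | rel2 : TorusRel θ μ (Wg * Log) ((starRingEnd ℂ (qc θ)) • (Log * Wg))
  | rel3 : TorusRel θ μ (Wog * Log) (qc θ • (Log * Wog))
  | rel4 : TorusRel θ μ (Wog * Lg) ((starRingEnd ℂ (qc θ)) • (Lg * Wog))
  | rel5 : TorusRel θ μ (Lg * Log) 1
  | rel6 : TorusRel θ μ (Log * Lg) 1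
  | rel7 : TorusRel θ μ (Wg * Wog)
      (zc θ • Lg + (starRingEnd ℂ (zc θ)) • Log + (μ : ℂ) • 1)
  | rel8 : TorusRel θ μ (Wog * Wg)
      (-((starRingEnd ℂ (zc θ)) • Lg) - zc θ • Log + (μ : ℂ) • 1)

/-- The deformed torus algebra `A⁰_{μ,θ}`: the quotient of the free algebra by the
two-sided ideal generated by the eight relations. -/
abbrev DefTorus (θ μ : ℝ) := RingQuot (TorusRel θ μ)

/-- The weighted shift `f ↦ (n ↦ c n * f (n + k))` on complex sequences indexed by `ℤ`. -/
def weightedShift (c : ℤ → ℂ) (k : ℤ) : Module.End ℂ (ℤ → ℂ) where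
  toFun f n := c n * f (n + k)
  map_add' f g := by ext n; simp [mul_add]
  map_smul' a f := by ext n; simp [mul_left_comm]

@[simp]
theorem weightedShift_apply (c : ℤ → ℂ) (k : ℤ) (f : ℤ → ℂ) (n : ℤ) :
    weightedShift c k f n = c n * f (n + k) := rfl

theorem qc_ne_zero (θ : ℝ) : qc θ ≠ 0 := Complex.exp_ne_zero _

theorem conj_qc (θ : ℝ) : starRingEnd ℂ (qc θ) = (qc θ)⁻¹ := by
  rw [qc, ← Complex.exp_conj, ← Complex.exp_neg]
  simp only [map_mul, Complex.conj_ofReal, Complex.conj_I, map_ofNat, mul_neg]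

theorem conj_zc_mul_qc (θ : ℝ) : starRingEnd ℂ (zc θ) * qc θ = -zc θ := by
  have h : Complex.exp (-(Real.pi * θ * Complex.I)) * qc θ
      = Complex.exp (Real.pi * θ * Complex.I) := by
    rw [qc, ← Complex.exp_add]
    ring_nf
  have hz : starRingEnd ℂ (zc θ) = Complex.exp (-(Real.pi * θ * Complex.I)) /
      (-(2 * Complex.I * (Real.cos (Real.pi * θ) : ℂ))) := by
    rw [zc, map_div₀, ← Complex.exp_conj]
    simp only [map_mul, Complex.conj_ofReal, Complex.conj_I, map_ofNat]
    ring_nf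
  rw [hz, div_mul_eq_mul_div, h, div_neg, zc]

/-- The images of the generators `W, W°, Λ, Λ°` as weighted shifts: `Λ` is diagonal with
eigenvalues `q ^ n`, and `W`, `W°` shift in opposite directions. -/
def torusGen (θ μ : ℝ) : Fin 4 → Module.End ℂ (ℤ → ℂ) :=
  ![weightedShift 1 1,
    weightedShift (fun n => -(starRingEnd ℂ (zc θ) * qc θ ^ n) - zc θ * (qc θ ^ n)⁻¹ + μ) (-1),
    weightedShift (fun n => qc θ ^ n) 0,
    weightedShift (fun n => (qc θ ^ n)⁻¹) 0]

theorem lift_torusGen_eq_of_torusRel (θ μ : ℝ) ⦃x y : FreeFour⦄ (h : TorusRel θ μ x y) :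
    FreeAlgebra.lift ℂ (torusGen θ μ) x = FreeAlgebra.lift ℂ (torusGen θ μ) y := by
  have hq := qc_ne_zero θ
  have hz : zc θ = -(starRingEnd ℂ (zc θ) * qc θ) := by rw [conj_zc_mul_qc, neg_neg]
  have hn (n : ℤ) : qc θ ^ n ≠ 0 := zpow_ne_zero n hq
  refine LinearMap.ext fun f => funext fun n => ?_
  cases h
  case rel7 =>
    simp [Wg, Wog, Lg, Log, torusGen, zpow_add₀ hq, -Complex.coe_smul]
    generalize starRingEnd ℂ (zc θ) = w at hz
    rw [hz]
    field_simp [hn n]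
    ring
  case rel8 =>
    simp [Wg, Wog, Lg, Log, torusGen, -Complex.coe_smul]
    ring
  case rel5 | rel6 => simp [Lg, Log, torusGen, hn n]
  all_goals
    simp [Wg, Wog, Lg, Log, torusGen, conj_qc, zpow_add₀ hq]
    field_simp

/-- If `μ > 0` and `|μ cos(πθ)| > 1`, the deformed torus algebra
`A⁰_{μ,θ}` is nontrivial: `1 ≠ 0`. -/
theorem stmt6 (θ μ : ℝ) (hμ : 0 < μ) (hμθ : 1 < |μ * Real.cos (Real.pi * θ)|) :
    (1 : DefTorus θ μ) ≠ 0 := by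
  intro h
  have h1 := congrArg
    (RingQuot.liftAlgHom ℂ ⟨FreeAlgebra.lift ℂ (torusGen θ μ), lift_torusGen_eq_of_torusRel θ μ⟩) h
  rw [map_one, map_zero] at h1
  exact one_ne_zero h1

end
end

section
/- Let m, n be integers with n ≥ 1, let θ, μ ∈ ℝ with cos(πθ) > 0 and μ cos(πθ) > 1, set ε = (m + nθ)/n, q = e^{2πiθ}, z = e^{iπθ}/(2i cos(πθ)), and for x ∈ ℝ, k ∈ ℤ define u(x,k) = x − mk/n and W(x,k) = √(μ + sin(2π u(x,k) − πθ)/cos(πθ)) (the expression under the root is positive). On the space of functions f : ℝ × (ℤ/nℤ) → ℂ define the operators: (f·W)(x,k) = W(x,k) f(x − ε, k − 1), (f·W°)(x,k) = W(x + ε, k + 1) f(x + ε, k + 1), (f·Λ)(x,k) = e^{2πi u(x,k)} f(x,k), (f·Λ°)(x,k) = e^{−2πi u(x,k)} f(x,k) (these are well defined since W(x,k) and e^{±2πi u(x,k)} depend on k only modulo n). Then for every f: ((f·W)·Λ) = q·((f·Λ)·W); ((f·W°)·Λ) = conj(q)·((f·Λ)·W°); ((f·Λ)·Λ°) = f = ((f·Λ°)·Λ);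 ((f·W)·W°) = z·(f·Λ) + conj(z)·(f·Λ°) + μ·f; and ((f·W°)·W) = −conj(z)·(f·Λ) − z·(f·Λ°) + μ·f. -/
open Real Complex

noncomputable section

/-- `u(x,k) = x − mk/n`, with `k ∈ ℤ/nℤ` represented by `k.val`. -/
def uFun (m : ℤ) (n : ℕ) (x : ℝ) (k : ZMod n) : ℝ :=
  x - (m : ℝ) * (k.val : ℝ) / (n : ℝ)

/-- `ε = (m + nθ)/n`. -/
def epsFun (m : ℤ) (n : ℕ) (θ : ℝ) : ℝ := ((m : ℝ) + (n : ℝ) * θ) / (n : ℝ)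

/-- `W(x,k) = √(μ + sin(2π u(x,k) − πθ)/cos(πθ))`. -/
def Wcoef (m : ℤ) (n : ℕ) (θ μ : ℝ) (x : ℝ) (k : ZMod n) : ℝ :=
  Real.sqrt (μ + Real.sin (2 * Real.pi * uFun m n x k - Real.pi * θ) /
    Real.cos (Real.pi * θ))

/-- Right action of `W`: `(f·W)(x,k) = W(x,k) f(x − ε, k − 1)`. -/
def actW (m : ℤ) (n : ℕ) (θ μ : ℝ) (f : ℝ × ZMod n → ℂ) : ℝ × ZMod n → ℂ :=
  fun p => (Wcoef m n θ μ p.1 p.2 : ℂ) * f (p.1 - epsFun m n θ, p.2 - 1)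

/-- Right action of `W°`: `(f·W°)(x,k) = W(x + ε, k + 1) f(x + ε, k + 1)`. -/
def actWo (m : ℤ) (n : ℕ) (θ μ : ℝ) (f : ℝ × ZMod n → ℂ) : ℝ × ZMod n → ℂ :=
  fun p => (Wcoef m n θ μ (p.1 + epsFun m n θ) (p.2 + 1) : ℂ) *
    f (p.1 + epsFun m n θ, p.2 + 1)

/-- Right action of `Λ`: `(f·Λ)(x,k) = e^{2πi u(x,k)} f(x,k)`. -/
def actL (m : ℤ) (n : ℕ) (f : ℝ × ZMod n → ℂ) : ℝ × ZMod n → ℂ :=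
  fun p => Complex.exp (2 * Real.pi * uFun m n p.1 p.2 * Complex.I) * f p

/-- Right action of `Λ°`: `(f·Λ°)(x,k) = e^{−2πi u(x,k)} f(x,k)`. -/
def actLo (m : ℤ) (n : ℕ) (f : ℝ × ZMod n → ℂ) : ℝ × ZMod n → ℂ :=
  fun p => Complex.exp (-(2 * Real.pi * uFun m n p.1 p.2 * Complex.I)) * f p

/-- Translating by `(ε, 1)` translates `u` by `θ` modulo an integer. -/
lemma exists_uFun_add (m : ℤ) (n : ℕ) (hn : 1 ≤ n) (θ x : ℝ) (k : ZMod n) :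
    ∃ j : ℤ, uFun m n (x + epsFun m n θ) (k + 1) = uFun m n x k + θ + j := by
  have : NeZero n := ⟨by omega⟩
  have h : (((k.val : ℤ) + 1 : ℤ) : ZMod n) = (((k + 1).val : ℤ) : ZMod n) := by
    push_cast
    simp
  obtain ⟨t, ht⟩ := (ZMod.intCast_eq_intCast_iff_dvd_sub _ _ n).1 h
  have ht' : ((k + 1).val : ℝ) = k.val + 1 + n * t := by
    have : ((k + 1).val : ℤ) = k.val + 1 + n * t := by linarith
    exact_mod_cast this
  have hn0 : (n : ℝ) ≠ 0 := NeZero.ne _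
  refine ⟨-(m * t), ?_⟩
  unfold uFun epsFun
  rw [ht']
  push_cast
  field_simp
  ring

/-- Translating by `(ε, 1)` multiplies `e^{2πi u}` by `e^{2πiθ}`. -/
lemma exp_uFun_add (m : ℤ) (n : ℕ) (hn : 1 ≤ n) (θ x : ℝ) (k : ZMod n) :
    Complex.exp (2 * Real.pi * uFun m n (x + epsFun m n θ) (k + 1) * Complex.I) =
      Complex.exp (2 * Real.pi * θ * Complex.I) *
        Complex.exp (2 * Real.pi * uFun m n x k * Complex.I) := by
  obtain ⟨j, hj⟩ := exists_uFun_add m n hn θ x k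
  rw [hj, ← Complex.exp_add, Complex.exp_eq_exp_iff_exists_int]
  refine ⟨j, ?_⟩
  push_cast
  ring

lemma sin_uFun_add (m : ℤ) (n : ℕ) (hn : 1 ≤ n) (θ x : ℝ) (k : ZMod n) :
    Real.sin (2 * Real.pi * uFun m n (x + epsFun m n θ) (k + 1) - Real.pi * θ) =
      Real.sin (2 * Real.pi * uFun m n x k + Real.pi * θ) := by
  obtain ⟨j, hj⟩ := exists_uFun_add m n hn θ x k
  rw [hj, ← Real.sin_add_int_mul_two_pi (2 * Real.pi * uFun m n x k + Real.pi * θ) j]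
  ring_nf

lemma add_sin_div_pos {c μ : ℝ} (hc : 0 < c) (h : 1 < μ * c) (a : ℝ) :
    0 < μ + Real.sin a / c := by
  have : μ + Real.sin a / c = (μ * c + Real.sin a) / c := by field_simp
  rw [this]
  exact div_pos (by linarith [Real.neg_one_le_sin a]) hc

lemma Wcoef_mul_self (m : ℤ) (n : ℕ) {θ μ : ℝ} (hθ : 0 < Real.cos (Real.pi * θ))
    (hμθ : 1 < μ * Real.cos (Real.pi * θ)) (x : ℝ) (k : ZMod n) :
    (Wcoef m n θ μ x k : ℂ) * Wcoef m n θ μ x k =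
      ((μ + Real.sin (2 * Real.pi * uFun m n x k - Real.pi * θ) /
        Real.cos (Real.pi * θ) : ℝ) : ℂ) := by
  rw [← Complex.ofReal_mul]
  exact congrArg _ (Real.mul_self_sqrt (add_sin_div_pos hθ hμθ _).le)

lemma ofReal_sin_eq (a : ℝ) :
    (Real.sin a : ℂ) =
      (Complex.exp (a * Complex.I) - Complex.exp (-(a * Complex.I))) / (2 * Complex.I) := by
  rw [Complex.ofReal_sin, Complex.sin, neg_mul]
  field_simp
  rw [Complex.I_sq]
  ring

lemma conj_exp_ofReal_mul_I (a : ℝ) :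
    starRingEnd ℂ (Complex.exp (a * Complex.I)) = Complex.exp (-(a * Complex.I)) := by
  rw [← Complex.exp_conj]
  simp

/-- The operators `W, W°, Λ, Λ°` on functions `ℝ × ℤ/nℤ → ℂ`
satisfy the right-module versions of the defining relations (arel1)–(arel5) of the
deformed torus algebra `A⁰_{μ,θ}`. -/
theorem stmt15 (m : ℤ) (n : ℕ) (hn : 1 ≤ n) (θ μ : ℝ)
    (hθ : 0 < Real.cos (Real.pi * θ)) (hμθ : 1 < μ * Real.cos (Real.pi * θ)) :
    let q : ℂ := Complex.exp (2 * Real.pi * θ * Complex.I)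
    let z : ℂ := Complex.exp (Real.pi * θ * Complex.I) /
      (2 * Complex.I * (Real.cos (Real.pi * θ) : ℂ))
    (∀ (x : ℝ) (k : ZMod n),
      0 < μ + Real.sin (2 * Real.pi * uFun m n x k - Real.pi * θ) /
        Real.cos (Real.pi * θ)) ∧
    ∀ f : ℝ × ZMod n → ℂ,
      actL m n (actW m n θ μ f) = q • actW m n θ μ (actL m n f) ∧
      actL m n (actWo m n θ μ f) = (starRingEnd ℂ q) • actWo m n θ μ (actL m n f) ∧
      actLo m n (actL m n f) = f ∧ actL m n (actLo m n f) = f ∧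
      actWo m n θ μ (actW m n θ μ f) =
        z • actL m n f + (starRingEnd ℂ z) • actLo m n f + (μ : ℂ) • f ∧
      actW m n θ μ (actWo m n θ μ f) =
        -((starRingEnd ℂ z) • actL m n f) - z • actLo m n f + (μ : ℂ) • f := by
  intro q z
  have hq : starRingEnd ℂ q * q = 1 := by
    have h := conj_exp_ofReal_mul_I (2 * Real.pi * θ)
    push_cast at h
    rw [h, ← Complex.exp_add, neg_add_cancel, Complex.exp_zero]
  have hz : starRingEnd ℂ z = -(Complex.exp (-(Real.pi * θ * Complex.I)) /
      (2 * Complex.I * (Real.cos (Real.pi * θ) : ℂ))) := by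
    have h := conj_exp_ofReal_mul_I (Real.pi * θ)
    rw [Complex.ofReal_mul] at h
    simp only [z, map_div₀, map_mul, h, Complex.conj_I, Complex.conj_ofReal, map_ofNat]
    rw [mul_neg, neg_mul, div_neg]
  have hc : (Real.cos (Real.pi * θ) : ℂ) ≠ 0 := Complex.ofReal_ne_zero.2 hθ.ne'
  refine ⟨fun x k => add_sin_div_pos hθ hμθ _, fun f => ⟨?_, ?_, ?_, ?_, ?_, ?_⟩⟩
  · funext ⟨x, k⟩
    have h := exp_uFun_add m n hn θ (x - epsFun m n θ) (k - 1)
    rw [sub_add_cancel, sub_add_cancel] at h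
    simp only [actL, actW, Pi.smul_apply, smul_eq_mul, h, q]
    ring
  · funext ⟨x, k⟩
    simp only [actL, actWo, Pi.smul_apply, smul_eq_mul, exp_uFun_add m n hn θ x k]
    linear_combination (-(Complex.exp (2 * Real.pi * uFun m n x k * Complex.I) *
      (Wcoef m n θ μ (x + epsFun m n θ) (k + 1) *
        f (x + epsFun m n θ, k + 1)))) * hq
  · funext p
    simp only [actL, actLo]
    rw [← mul_assoc, ← Complex.exp_add, neg_add_cancel, Complex.exp_zero, one_mul]
  · funext p
    simp only [actL, actLo]
    rw [← mul_assoc, ← Complex.exp_add, add_neg_cancel, Complex.exp_zero, one_mul]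
  · funext ⟨x, k⟩
    simp only [actL, actLo, actW, actWo, Pi.smul_apply, Pi.add_apply, smul_eq_mul,
      add_sub_cancel_right]
    rw [← mul_assoc, Wcoef_mul_self m n hθ hμθ, sin_uFun_add m n hn, hz, Complex.ofReal_add,
      Complex.ofReal_div, ofReal_sin_eq]
    push_cast
    rw [add_mul (2 * Real.pi * uFun m n x k : ℂ), neg_add, Complex.exp_add, Complex.exp_add]
    simp only [z]
    push_cast at hc ⊢
    field_simp
    ring
  · funext ⟨x, k⟩
    simp only [actL, actLo, actW, actWo, Pi.smul_apply, Pi.add_apply, Pi.sub_apply,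
      Pi.neg_apply, smul_eq_mul, sub_add_cancel]
    rw [← mul_assoc, Wcoef_mul_self m n hθ hμθ, hz, Complex.ofReal_add,
      Complex.ofReal_div, ofReal_sin_eq]
    push_cast
    rw [sub_mul, neg_sub, sub_eq_add_neg (2 * Real.pi * uFun m n x k * Complex.I : ℂ),
      sub_eq_add_neg (Real.pi * θ * Complex.I : ℂ),
      Complex.exp_add, Complex.exp_add]
    simp only [z]
    push_cast at hc ⊢
    field_simp
    ring

end
end
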